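/- There exist universal constants c, c' > 0 with the following property. Let ε, δ ∈ (0,1) and d ∈ ℕ. There exists an estimator κ̂ : Ω^m → (0,1) such that for every ergodic Markov chain X₁, …, X_m ~ (μ, M) on Ω with |Ω| = d, minimum stationary probability π_min and generalized contraction coefficient κ̃, whenever m ≥ c 𝓛 d / (π_min (1 − κ̃)² ε²) with 𝓛 = c' · ln(d/(δ ε π_min (1 − κ̃))) · ln ln(d/(δ ε π_min (1 − κ̃))), the relative-error bound |(1 − κ̂(X₁,…,X_m))/(1 − κ̃) − 1| < ε holds with probability at least 1 − δ. -/

import Mathlib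

variable {Ω : Type*} [Fintype Ω] [DecidableEq Ω] [Nonempty Ω]

/-- A probability distribution on `Ω`. -/
def IsDist (f : Ω → ℝ) : Prop := (∀ x, 0 ≤ f x) ∧ ∑ x, f x = 1

/-- A row-stochastic (Markov) matrix. -/
def IsStochastic (M : Matrix Ω Ω ℝ) : Prop :=
  (∀ i j, 0 ≤ M i j) ∧ ∀ i, ∑ j, M i j = 1

/-- Ergodicity: some power of `M` is entrywise positive. -/
def IsErgodic (M : Matrix Ω Ω ℝ) : Prop := ∃ p : ℕ, 0 < p ∧ ∀ i j, 0 < (M ^ p) i j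

/-- Total variation distance between two distributions on `Ω`. -/
noncomputable def tvDist (μ ν : Ω → ℝ) : ℝ := (1 / 2) * ∑ x, |μ x - ν x|

/-- Dobrushin contraction coefficient `κ(M) = max_{i,j} ‖M(i,·) − M(j,·)‖_TV`. -/
noncomputable def dobrushin (M : Matrix Ω Ω ℝ) : ℝ :=
  Finset.univ.sup' Finset.univ_nonempty fun p : Ω × Ω => tvDist (M p.1) (M p.2)

/-- Generalized contraction coefficient `κ̃ = 1 − sup_{s ≥ 1} (1 − κ(M^s))/s`. -/
noncomputable def genCC (M : Matrix Ω Ω ℝ) : ℝ :=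
  1 - ⨆ s : {n : ℕ // 0 < n}, (1 - dobrushin (M ^ (s : ℕ))) / ((s : ℕ) : ℝ)

/-- Distance to stationarity `h(t) = sup_{μ ∈ Δ_Ω} ‖μ M^t − π‖_TV`. -/
noncomputable def distToStat (M : Matrix Ω Ω ℝ) (π : Ω → ℝ) (t : ℕ) : ℝ :=
  ⨆ μ : {f : Ω → ℝ // IsDist f}, tvDist (Matrix.vecMul μ.1 (M ^ t)) π

/-- Mixing time `t_mix(ξ) = min{t ∈ ℕ : h(t) < ξ}` (with `ℕ = {1,2,…}`). -/
noncomputable def mixTime (M : Matrix Ω Ω ℝ) (π : Ω → ℝ) (ξ : ℝ) : ℕ :=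
  sInf {t : ℕ | 0 < t ∧ distToStat M π t < ξ}

/-- Probability of observing the trajectory `x = (X₁, …, X_m)` for the Markov chain
with initial distribution `μ` and transition matrix `M`. -/
noncomputable def pathProb (μ : Ω → ℝ) (M : Matrix Ω Ω ℝ) {m : ℕ} (x : Fin m → Ω) : ℝ :=
  if h : m = 0 then 1
  else
    μ (x ⟨0, Nat.pos_of_ne_zero h⟩) *
      ∏ t : Fin (m - 1),
        M (x ⟨t.1, by have := t.2; omega⟩) (x ⟨t.1 + 1, by have := t.2; omega⟩)

/-- Probability of an event `E` under the law of the trajectory `(X₁, …, X_m) ∼ (μ, M)`. -/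
noncomputable def prTraj (μ : Ω → ℝ) (M : Matrix Ω Ω ℝ) (m : ℕ)
    (E : Set (Fin m → Ω)) : ℝ :=
  ∑ x : Fin m → Ω, E.indicator (pathProb μ M) x

/-- `N_i^{(s)}`: number of visits to state `i` by the `s`-skipped chain, i.e. the number of
`t ∈ {1, …, ⌊(m−1)/s⌋}` such that `X_{1+s(t−1)} = i`. -/
def Nvisit (s : ℕ) {m : ℕ} (x : Fin m → Ω) (i : Ω) : ℕ :=
  ∑ t : Fin ((m - 1) / s),
    if h : s * t.1 < m then (if x ⟨s * t.1, h⟩ = i then 1 else 0) else 0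

/-- `N_min^{(s)}`: the least number of visits of the `s`-skipped chain. -/
def Nmin (s : ℕ) {m : ℕ} (x : Fin m → Ω) : ℕ :=
  Finset.univ.inf' Finset.univ_nonempty (Nvisit s x)

/-- `N_{ij}^{(s)}`: number of observed transitions `i → j` of the `s`-skipped chain. -/
def Npair (s : ℕ) {m : ℕ} (x : Fin m → Ω) (i j : Ω) : ℕ :=
  ∑ t : Fin ((m - 1) / s),
    if h : s * t.1 + s < m then
      (if x ⟨s * t.1, Nat.lt_of_le_of_lt (Nat.le_add_right _ _) h⟩ = i ∧
          x ⟨s * t.1 + s, h⟩ = j then 1 else 0)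
    else 0

/-- Empirical `s`-step transition matrix `M̂^{(s)}`. -/
noncomputable def empMat (s : ℕ) {m : ℕ} (x : Fin m → Ω) : Matrix Ω Ω ℝ :=
  Matrix.of fun i j =>
    if 0 < Nvisit s x i then (Npair s x i j : ℝ) / (Nvisit s x i : ℝ) else 0

/-- Minimum stationary probability `π_min`. -/
noncomputable def piMinOf (π : Ω → ℝ) : ℝ :=
  Finset.univ.inf' Finset.univ_nonempty π

/-- The sequence `a, x 0, x 1, …`. -/
def consSeq (a : Ω) (x : ℕ → Ω) : ℕ → Ω
  | 0 => a
  | t + 1 => x t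

/-- Expectation of `F` along the Markov chain run for `m` steps from `a`, and then frozen. -/
noncomputable def pathExp (M : Matrix Ω Ω ℝ) : ℕ → Ω → ((ℕ → Ω) → ℝ) → ℝ
  | 0, a, F => F fun _ => a
  | m + 1, a, F => ∑ b, M a b * pathExp M m b fun x => F (consSeq a x)

omit [DecidableEq Ω] [Nonempty Ω] in
lemma pathExp_mono {M : Matrix Ω Ω ℝ} (hM : ∀ i j, 0 ≤ M i j) (m : ℕ) (a : Ω)
    {F G : (ℕ → Ω) → ℝ} (h : ∀ x, x 0 = a → F x ≤ G x) :
    pathExp M m a F ≤ pathExp M m a G := by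
  induction m generalizing a F G with
  | zero => exact h _ rfl
  | succ m ih =>
    exact Finset.sum_le_sum fun b _ =>
      mul_le_mul_of_nonneg_left (ih b fun x _ => h _ rfl) (hM a b)

omit [DecidableEq Ω] [Nonempty Ω] in
lemma pathExp_congr {M : Matrix Ω Ω ℝ} (m : ℕ) (a : Ω)
    {F G : (ℕ → Ω) → ℝ} (h : ∀ x, x 0 = a → F x = G x) :
    pathExp M m a F = pathExp M m a G := by
  induction m generalizing a F G with
  | zero => exact h _ rfl
  | succ m ih =>
    exact Finset.sum_congr rfl fun b _ => by rw [ih b fun x _ => h _ rfl]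

omit [DecidableEq Ω] [Nonempty Ω] in
lemma pathExp_const_mul (M : Matrix Ω Ω ℝ) (m : ℕ) (a : Ω) (c : ℝ) (F : (ℕ → Ω) → ℝ) :
    pathExp M m a (fun x => c * F x) = c * pathExp M m a F := by
  induction m generalizing a F with
  | zero => rfl
  | succ m ih =>
    simp only [pathExp, Finset.mul_sum]
    exact Finset.sum_congr rfl fun b _ => by rw [ih b fun x => F (consSeq a x)]; ring

omit [DecidableEq Ω] [Nonempty Ω] in
lemma pathExp_one {M : Matrix Ω Ω ℝ} (hM : IsStochastic M) (m : ℕ) (a : Ω) :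
    pathExp M m a (fun _ => 1) = 1 := by
  induction m generalizing a with
  | zero => rfl
  | succ m ih => simp only [pathExp, ih, mul_one, hM.2]

omit [Nonempty Ω] in
lemma pathExp_shift (M : Matrix Ω Ω ℝ) (s m : ℕ) (a : Ω) (F : (ℕ → Ω) → ℝ) :
    pathExp M (m + s) a (fun x => F fun t => x (t + s)) =
      ∑ b, (M ^ s) a b * pathExp M m b F := by
  induction s generalizing a with
  | zero => simp [Matrix.one_apply]
  | succ s ih =>
    have h : ∀ b, pathExp M (m + s) b (fun x => F fun t => consSeq a x (t + (s + 1))) =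
        ∑ c, (M ^ s) b c * pathExp M m c F := fun b => ih b
    rw [← add_assoc, pathExp]
    simp only [h, pow_succ', Matrix.mul_apply, Finset.mul_sum, Finset.sum_mul]
    rw [Finset.sum_comm]
    exact Finset.sum_congr rfl fun _ _ => Finset.sum_congr rfl fun _ _ => by ring

omit [Nonempty Ω] in
/-- A multiplicative supermartingale bound for the `s`-skipped chain. -/
lemma pathExp_prod_le {M : Matrix Ω Ω ℝ} (hM : IsStochastic M) {s : ℕ}
    (w : Ω → Ω → ℝ) (hw : ∀ a b, 0 ≤ w a b) (V : Ω → ℝ) {ρ : ℝ} (hρ : 0 ≤ ρ)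
    (h : ∀ a, ∑ b, (M ^ s) a b * (w a b * V b) ≤ ρ * V a)
    (hP : ∀ a b, 0 ≤ (M ^ s) a b)
    (n m : ℕ) (hnm : s * n ≤ m) (a : Ω) :
    pathExp M m a (fun x => (∏ k ∈ Finset.range n, w (x (s * k)) (x (s * k + s))) * V (x (s * n)))
      ≤ ρ ^ n * V a := by
  induction n generalizing m a with
  | zero =>
    have : pathExp M m a (fun x => (∏ k ∈ Finset.range 0, w (x (s * k)) (x (s * k + s))) *
        V (x (s * 0))) = pathExp M m a (fun _ => V a * 1) := by
      refine pathExp_congr m a fun x hx => by simp [hx]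
    rw [this, pathExp_const_mul, pathExp_one hM]
    simp
  | succ n ih =>
    obtain ⟨m, rfl⟩ : ∃ m', m = m' + s := ⟨m - s, by
      have : s ≤ m := le_trans (by rw [mul_add, mul_one]; exact Nat.le_add_left _ _) hnm
      omega⟩
    have hnm' : s * n ≤ m := by rw [mul_add, mul_one] at hnm; omega
    let G : (ℕ → Ω) → ℝ := fun x => w a (x 0) *
      ((∏ k ∈ Finset.range n, w (x (s * k)) (x (s * k + s))) * V (x (s * n)))
    have e1 : pathExp M (m + s) a (fun x => (∏ k ∈ Finset.range (n + 1),
        w (x (s * k)) (x (s * k + s))) * V (x (s * (n + 1)))) =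
        pathExp M (m + s) a (fun x => G fun t => x (t + s)) := by
      refine pathExp_congr _ a fun x hx => ?_
      simp only [G, Finset.prod_range_succ', mul_zero, hx, zero_add, mul_add, mul_one]
      ring
    rw [e1, pathExp_shift]
    have e2 : ∀ b, pathExp M m b G ≤ w a b * (ρ ^ n * V b) := fun b => by
      have : pathExp M m b G = pathExp M m b (fun x => w a b *
          ((∏ k ∈ Finset.range n, w (x (s * k)) (x (s * k + s))) * V (x (s * n)))) :=
        pathExp_congr m b fun x hx => by simp only [G, hx]
      rw [this, pathExp_const_mul]
      exact mul_le_mul_of_nonneg_left (ih m hnm' b) (hw a b)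
    calc ∑ b, (M ^ s) a b * pathExp M m b G
        ≤ ∑ b, (M ^ s) a b * (w a b * (ρ ^ n * V b)) :=
          Finset.sum_le_sum fun b _ => mul_le_mul_of_nonneg_left (e2 b) (hP a b)
      _ = ρ ^ n * ∑ b, (M ^ s) a b * (w a b * V b) := by
          rw [Finset.mul_sum]; exact Finset.sum_congr rfl fun b _ => by ring
      _ ≤ ρ ^ n * (ρ * V a) := mul_le_mul_of_nonneg_left (h a) (pow_nonneg hρ n)
      _ = ρ ^ (n + 1) * V a := by ring

omit [Fintype Ω] [DecidableEq Ω] [Nonempty Ω] in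
lemma pathProb_cons (μ : Ω → ℝ) (M : Matrix Ω Ω ℝ) {m : ℕ} (a : Ω) (x : Fin (m + 1) → Ω) :
    pathProb μ M (Fin.cons a x : Fin (m + 2) → Ω) = μ a * pathProb (M a) M x := by
  simp only [pathProb, Nat.succ_ne_zero, dite_false]
  congr 1
  exact Fin.prod_univ_succ (n := m) fun t => M ((Fin.cons a x : Fin (m + 2) → Ω) t.castSucc)
    ((Fin.cons a x : Fin (m + 2) → Ω) t.succ)

omit [DecidableEq Ω] [Nonempty Ω] in
lemma sum_pathProb_mul (μ : Ω → ℝ) (M : Matrix Ω Ω ℝ) (m : ℕ) (F : (Fin (m + 1) → Ω) → ℝ) :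
    ∑ x, pathProb μ M x * F x = ∑ a, μ a * pathExp M m a fun x => F fun t => x t := by
  induction m generalizing μ with
  | zero =>
    rw [← (Equiv.funUnique (Fin 1) Ω).symm.sum_comp]
    refine Finset.sum_congr rfl fun a _ => ?_
    simp only [pathProb, pathExp]
    simp
    left
    rfl
  | succ m ih =>
    rw [← (Fin.consEquiv fun _ : Fin (m + 2) => Ω).sum_comp, Fintype.sum_prod_type]
    refine Finset.sum_congr rfl fun a _ => ?_
    have h2 : ∀ x : ℕ → Ω, (fun t : Fin (m + 2) => consSeq a x t) =
        Fin.cons a (fun t : Fin (m + 1) => x t) := fun x => by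
      ext t; refine Fin.cases ?_ (fun t => ?_) t <;> rfl
    have h1 : ∀ y : Fin (m + 1) → Ω, pathProb μ M (Fin.consEquiv (fun _ => Ω) (a, y)) *
        F (Fin.consEquiv (fun _ => Ω) (a, y)) =
        μ a * (pathProb (M a) M y * F (Fin.cons a y)) := fun y => by
      rw [← mul_assoc, ← pathProb_cons]; rfl
    rw [Finset.sum_congr rfl fun y _ => h1 y, ← Finset.mul_sum, ih (M a) fun y => F (Fin.cons a y)]
    simp only [pathExp, h2]

omit [DecidableEq Ω] [Nonempty Ω] in
lemma IsStochastic.mul {A B : Matrix Ω Ω ℝ} (hA : IsStochastic A) (hB : IsStochastic B) :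
    IsStochastic (A * B) := by
  refine ⟨fun i j => Finset.sum_nonneg fun k _ => mul_nonneg (hA.1 i k) (hB.1 k j), fun i => ?_⟩
  simp only [Matrix.mul_apply]
  rw [Finset.sum_comm]
  simp only [← Finset.mul_sum, hB.2, mul_one, hA.2]

omit [Nonempty Ω] in
lemma IsStochastic.pow {M : Matrix Ω Ω ℝ} (hM : IsStochastic M) (n : ℕ) :
    IsStochastic (M ^ n) := by
  induction n with
  | zero =>
    refine ⟨fun i j => ?_, fun i => by simp [Matrix.one_apply]⟩
    rw [pow_zero, Matrix.one_apply]
    split_ifs <;> norm_num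
  | succ n ih => rw [pow_succ]; exact ih.mul hM

omit [DecidableEq Ω] in
lemma tvDist_le_dobrushin (M : Matrix Ω Ω ℝ) (i j : Ω) : tvDist (M i) (M j) ≤ dobrushin M :=
  Finset.le_sup' (fun p : Ω × Ω => tvDist (M p.1) (M p.2)) (Finset.mem_univ (i, j))

omit [DecidableEq Ω] [Nonempty Ω] in
lemma tvDist_nonneg (p q : Ω → ℝ) : 0 ≤ tvDist p q :=
  mul_nonneg (by norm_num) (Finset.sum_nonneg fun _ _ => abs_nonneg _)

omit [DecidableEq Ω] in
lemma dobrushin_nonneg (M : Matrix Ω Ω ℝ) : 0 ≤ dobrushin M :=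
  (tvDist_nonneg _ _).trans
    (tvDist_le_dobrushin M (Classical.arbitrary Ω) (Classical.arbitrary Ω))

omit [DecidableEq Ω] in
lemma dobrushin_le {M : Matrix Ω Ω ℝ} {r : ℝ} (h : ∀ i j, tvDist (M i) (M j) ≤ r) :
    dobrushin M ≤ r :=
  Finset.sup'_le _ _ fun p _ => h p.1 p.2

omit [DecidableEq Ω] in
lemma dobrushin_le_one {M : Matrix Ω Ω ℝ} (hM : IsStochastic M) : dobrushin M ≤ 1 := by
  refine dobrushin_le fun i j => ?_
  have : ∑ x, |M i x - M j x| ≤ ∑ x, (M i x + M j x) := Finset.sum_le_sum fun x _ => by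
    rw [abs_le]; constructor <;> linarith [hM.1 i x, hM.1 j x]
  rw [Finset.sum_add_distrib, hM.2, hM.2] at this
  unfold tvDist; linarith

omit [DecidableEq Ω] in
/-- `B` contracts the `ℓ¹` norm of vectors of total mass zero by its Dobrushin coefficient. -/
lemma sum_abs_vecMul_le (B : Matrix Ω Ω ℝ) (v : Ω → ℝ) (hv : ∑ x, v x = 0) :
    ∑ j, |∑ x, v x * B x j| ≤ dobrushin B * ∑ x, |v x| := by
  set w : ℝ := ∑ x, (v x)⁺ with hw
  have hneg : ∑ x, (v x)⁻ = w := by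
    have : ∑ x, ((v x)⁺ - (v x)⁻) = 0 := by simpa only [posPart_sub_negPart] using hv
    rw [Finset.sum_sub_distrib] at this; linarith
  have habs : ∑ x, |v x| = 2 * w := by
    simp only [← posPart_add_negPart, Finset.sum_add_distrib, hneg, ← hw]; ring
  have hw0 : 0 ≤ w := Finset.sum_nonneg fun x _ => posPart_nonneg _
  rcases hw0.eq_or_lt with h0 | h0
  · have hz : ∀ x, v x = 0 := fun x => by
      have := (Finset.sum_eq_zero_iff_of_nonneg fun x _ => abs_nonneg (v x)).1
        (by rw [habs, ← h0, mul_zero]) x (Finset.mem_univ x)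
      exact abs_eq_zero.1 this
    simp [hz]
  have key : ∀ j, w * ∑ x, v x * B x j =
      ∑ x, ∑ y, (v x)⁺ * (v y)⁻ * (B x j - B y j) := fun j => by
    have e1 : ∑ x, ∑ y, (v x)⁺ * (v y)⁻ * (B x j - B y j) =
        (∑ x, (v x)⁺ * B x j) * ∑ y, (v y)⁻ - (∑ x, (v x)⁺) * ∑ y, (v y)⁻ * B y j := by
      rw [Finset.sum_mul_sum, Finset.sum_mul_sum, ← Finset.sum_sub_distrib]
      refine Finset.sum_congr rfl fun x _ => ?_
      rw [← Finset.sum_sub_distrib]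
      exact Finset.sum_congr rfl fun y _ => by ring
    rw [e1, hneg, ← hw, mul_comm _ w, ← mul_sub, ← Finset.sum_sub_distrib]
    congr 1
    refine Finset.sum_congr rfl fun x _ => ?_
    rw [← sub_mul, posPart_sub_negPart]
  have h2 : w * ∑ j, |∑ x, v x * B x j| ≤ w * (dobrushin B * (2 * w)) := by
    calc w * ∑ j, |∑ x, v x * B x j| = ∑ j, |∑ x, ∑ y, (v x)⁺ * (v y)⁻ * (B x j - B y j)| := by
          rw [Finset.mul_sum]
          exact Finset.sum_congr rfl fun j _ => by rw [← key, abs_mul, abs_of_pos h0]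
      _ ≤ ∑ j, ∑ x, ∑ y, (v x)⁺ * (v y)⁻ * |B x j - B y j| := by
          refine Finset.sum_le_sum fun j _ => (Finset.abs_sum_le_sum_abs _ _).trans ?_
          refine Finset.sum_le_sum fun x _ => (Finset.abs_sum_le_sum_abs _ _).trans ?_
          refine Finset.sum_le_sum fun y _ => ?_
          rw [abs_mul, abs_of_nonneg (mul_nonneg (posPart_nonneg _) (negPart_nonneg _))]
      _ = ∑ x, ∑ y, (v x)⁺ * (v y)⁻ * ∑ j, |B x j - B y j| := by
          rw [Finset.sum_comm]
          refine Finset.sum_congr rfl fun x _ => ?_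
          rw [Finset.sum_comm]
          exact Finset.sum_congr rfl fun y _ => (Finset.mul_sum _ _ _).symm
      _ ≤ ∑ x, ∑ y, (v x)⁺ * (v y)⁻ * (2 * dobrushin B) := by
          refine Finset.sum_le_sum fun x _ => Finset.sum_le_sum fun y _ =>
            mul_le_mul_of_nonneg_left ?_ (mul_nonneg (posPart_nonneg _) (negPart_nonneg _))
          have := tvDist_le_dobrushin B x y
          unfold tvDist at this; linarith
      _ = w * (dobrushin B * (2 * w)) := by
          simp only [← Finset.sum_mul, ← Finset.mul_sum, hneg, ← hw]; ring
  rw [habs]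
  exact le_of_mul_le_mul_left h2 h0

omit [DecidableEq Ω] in
lemma dobrushin_mul_le {A B : Matrix Ω Ω ℝ} (hA : IsStochastic A) :
    dobrushin (A * B) ≤ dobrushin A * dobrushin B := by
  refine dobrushin_le fun i j => ?_
  have h := sum_abs_vecMul_le B (fun x => A i x - A j x)
    (by rw [Finset.sum_sub_distrib, hA.2, hA.2, sub_self])
  have h1 := tvDist_le_dobrushin A i j
  have e : ∀ y, (A * B) i y - (A * B) j y = ∑ x, (A i x - A j x) * B x y := fun y => by
    simp only [Matrix.mul_apply, ← Finset.sum_sub_distrib, sub_mul]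
  have h2 := mul_le_mul_of_nonneg_left h1 (dobrushin_nonneg B)
  unfold tvDist at *
  simp only [e]
  linarith

lemma dobrushin_pow_le {M : Matrix Ω Ω ℝ} (hM : IsStochastic M) (k : ℕ) :
    dobrushin (M ^ k) ≤ dobrushin M ^ k := by
  induction k with
  | zero => simpa using dobrushin_le_one (hM.pow 0)
  | succ k ih =>
    rw [pow_succ, pow_succ]
    exact (dobrushin_mul_le (hM.pow k)).trans
      (mul_le_mul_of_nonneg_right ih (dobrushin_nonneg M))

lemma dobrushin_pow_le_exp {M : Matrix Ω Ω ℝ} (hM : IsStochastic M) {s : ℕ} (hs : 0 < s) {r : ℝ}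
    (hr : 0 ≤ r) (h : dobrushin (M ^ s) ≤ 1 - r * s) (n : ℕ) :
    dobrushin (M ^ n) ≤ Real.exp (1 - r * n) := by
  have hs' : (0 : ℝ) < s := by exact_mod_cast hs
  have h1 : dobrushin (M ^ n) ≤ dobrushin (M ^ s) ^ (n / s) := by
    conv_lhs => rw [← Nat.div_add_mod n s, pow_add, pow_mul]
    refine (dobrushin_mul_le ((hM.pow s).pow _)).trans ?_
    have h2 := dobrushin_pow_le (hM.pow s) (n / s)
    have h3 := dobrushin_le_one (hM.pow (n % s))
    nlinarith [dobrushin_nonneg ((M ^ s) ^ (n / s)), dobrushin_nonneg (M ^ (n % s))]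
  have h2 : dobrushin (M ^ s) ≤ Real.exp (-(r * s)) :=
    h.trans (by linarith [Real.add_one_le_exp (-(r * s))])
  refine h1.trans ((pow_le_pow_left₀ (dobrushin_nonneg _) h2 _).trans ?_)
  rw [← Real.exp_nat_mul, Real.exp_le_exp]
  have hrs : r * s ≤ 1 := by linarith [dobrushin_nonneg (M ^ s)]
  have h4 : (n : ℝ) ≤ s * ((n / s : ℕ) : ℝ) + s := by
    have : n ≤ s * (n / s) + s := by
      have := Nat.div_add_mod n s
      have := Nat.mod_lt n hs
      omega
    exact_mod_cast this
  nlinarith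

lemma genCC_bddAbove (M : Matrix Ω Ω ℝ) :
    BddAbove (Set.range fun s : {n : ℕ // 0 < n} =>
      (1 - dobrushin (M ^ (s : ℕ))) / ((s : ℕ) : ℝ)) := by
  refine ⟨1, ?_⟩
  rintro _ ⟨s, rfl⟩
  have : (1 : ℝ) ≤ ((s : ℕ) : ℝ) := by exact_mod_cast s.2
  exact (div_le_one (by linarith)).2 (by linarith [dobrushin_nonneg (M ^ (s : ℕ))])

lemma div_le_one_sub_genCC (M : Matrix Ω Ω ℝ) {s : ℕ} (hs : 0 < s) :
    (1 - dobrushin (M ^ s)) / s ≤ 1 - genCC M := by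
  have := le_ciSup (genCC_bddAbove M) ⟨s, hs⟩
  unfold genCC
  linarith

lemma exists_lt_of_lt_one_sub_genCC (M : Matrix Ω Ω ℝ) {r : ℝ} (hr : r < 1 - genCC M) :
    ∃ s : ℕ, 0 < s ∧ r < (1 - dobrushin (M ^ s)) / s := by
  have : Nonempty {n : ℕ // 0 < n} := ⟨⟨1, one_pos⟩⟩
  have h : r < ⨆ s : {n : ℕ // 0 < n}, (1 - dobrushin (M ^ (s : ℕ))) / ((s : ℕ) : ℝ) := by
    unfold genCC at hr; linarith
  obtain ⟨s, hs⟩ := exists_lt_of_lt_ciSup h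
  exact ⟨s, s.2, hs⟩

lemma one_sub_genCC_le_one (M : Matrix Ω Ω ℝ) : 1 - genCC M ≤ 1 := by
  by_contra! h
  obtain ⟨s, hs, h⟩ := exists_lt_of_lt_one_sub_genCC M h
  have : (1 : ℝ) ≤ s := by exact_mod_cast hs
  rw [lt_div_iff₀ (by linarith)] at h
  linarith [dobrushin_nonneg (M ^ s)]

lemma one_sub_genCC_pos {M : Matrix Ω Ω ℝ} (hM : IsStochastic M) (hE : IsErgodic M) :
    0 < 1 - genCC M := by
  obtain ⟨p, hp, hpos⟩ := hE
  have hp' : (0 : ℝ) < p := by exact_mod_cast hp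
  refine lt_of_lt_of_le (div_pos ?_ hp') (div_le_one_sub_genCC M hp)
  rw [sub_pos]
  refine (Finset.sup'_lt_iff _).2 fun q _ => ?_
  have : ∑ x, |(M ^ p) q.1 x - (M ^ p) q.2 x| < ∑ x, ((M ^ p) q.1 x + (M ^ p) q.2 x) :=
    Finset.sum_lt_sum_of_nonempty Finset.univ_nonempty fun x _ => by
      rw [abs_lt]; constructor <;> linarith [hpos q.1 x, hpos q.2 x]
  rw [Finset.sum_add_distrib, (hM.pow p).2, (hM.pow p).2] at this
  unfold tvDist; linarith

omit [Nonempty Ω] in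
lemma vecMul_pow_eq {M : Matrix Ω Ω ℝ} {π : Ω → ℝ} (h : Matrix.vecMul π M = π) (n : ℕ) :
    Matrix.vecMul π (M ^ n) = π := by
  induction n with
  | zero => simp
  | succ n ih => rw [pow_succ, ← Matrix.vecMul_vecMul, ih, h]

lemma piMinOf_pos {M : Matrix Ω Ω ℝ} (hE : IsErgodic M) {π : Ω → ℝ} (hπ : IsDist π)
    (h : Matrix.vecMul π M = π) : 0 < piMinOf π := by
  obtain ⟨p, -, hpos⟩ := hE
  refine (Finset.lt_inf'_iff _).2 fun i _ => ?_
  rw [← vecMul_pow_eq h p]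
  obtain ⟨j, hj⟩ : ∃ j, 0 < π j := by
    by_contra! hn
    linarith [hπ.2, Finset.sum_nonpos fun j (_ : j ∈ Finset.univ) => hn j]
  exact Finset.sum_pos' (fun k _ => mul_nonneg (hπ.1 k) (hpos k i).le)
    ⟨j, Finset.mem_univ j, mul_pos hj (hpos j i)⟩

omit [DecidableEq Ω] in
lemma piMinOf_le (π : Ω → ℝ) (i : Ω) : piMinOf π ≤ π i := Finset.inf'_le _ (Finset.mem_univ i)

omit [DecidableEq Ω] in
lemma card_mul_piMinOf_le {π : Ω → ℝ} (hπ : IsDist π) :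
    (Fintype.card Ω : ℝ) * piMinOf π ≤ 1 := by
  rw [← hπ.2, ← nsmul_eq_mul]
  exact Finset.card_nsmul_le_sum _ _ _ fun i _ => piMinOf_le π i

omit [DecidableEq Ω] in
lemma abs_sub_le_two_mul_dobrushin (M : Matrix Ω Ω ℝ) (x y i : Ω) :
    |M x i - M y i| ≤ 2 * dobrushin M := by
  have h1 := tvDist_le_dobrushin M x y
  have h2 := Finset.single_le_sum (f := fun i => |M x i - M y i|) (fun j _ => abs_nonneg _)
    (Finset.mem_univ i)
  unfold tvDist at h1
  linarith

/-- An approximate solution of Poisson's equation for the indicator of `i`. -/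
lemma exists_poisson {P : Matrix Ω Ω ℝ} (hP : IsStochastic P) {π : Ω → ℝ} (hπ : IsDist π)
    (hs : Matrix.vecMul π P = π) {r : ℝ} (hr : 0 < r) (hr1 : r ≤ 1)
    (hd : ∀ n : ℕ, dobrushin (P ^ n) ≤ Real.exp (1 - r * n)) (i : Ω) (hi : 0 < π i) :
    ∃ h : Ω → ℝ, (∀ x, 0 ≤ h x) ∧ (∀ x, h x ≤ 12 / r) ∧
      ∀ x, h x + π i / 2 - (if x = i then 1 else 0) ≤ ∑ y, P x y * h y := by
  obtain ⟨T, hT⟩ : ∃ T : ℕ, ∀ x, π i / 2 ≤ (P ^ T) x i := by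
    have hlim : Filter.Tendsto (fun n : ℕ => Real.exp (1 - r * n)) Filter.atTop (nhds 0) := by
      refine Real.tendsto_exp_atBot.comp ?_
      refine Filter.tendsto_atBot_add_const_left _ 1 ?_ |>.congr fun n => (sub_eq_add_neg _ _).symm
      exact Filter.tendsto_neg_atTop_atBot.comp
        (tendsto_natCast_atTop_atTop.const_mul_atTop hr)
    obtain ⟨T, hT⟩ := (hlim.eventually (gt_mem_nhds (show (0 : ℝ) < π i / 4 by linarith))).exists
    refine ⟨T, fun x => ?_⟩
    have h1 : π i = ∑ y, π y * (P ^ T) y i := by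
      conv_lhs => rw [← vecMul_pow_eq hs T]
      rfl
    have h2 : ∑ y, π y * (P ^ T) y i ≤ ∑ y, π y * ((P ^ T) x i + π i / 2) :=
      Finset.sum_le_sum fun y _ => mul_le_mul_of_nonneg_left (by
        have := (abs_le.1 (abs_sub_le_two_mul_dobrushin (P ^ T) x y i)).1
        linarith [hd T]) (hπ.1 y)
    rw [← h1, ← Finset.sum_mul, hπ.2] at h2
    linarith
  set f : Ω → ℝ := fun x => ∑ u ∈ Finset.range T, (P ^ u) x i with hf
  have hgeo : ∑ u ∈ Finset.range T, Real.exp (1 - r * u) ≤ 6 / r := by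
    have hq : ∀ u : ℕ, Real.exp (1 - r * u) = Real.exp 1 * Real.exp (-r) ^ u := fun u => by
      rw [← Real.exp_nat_mul, ← Real.exp_add]; ring_nf
    have hlt : Real.exp (-r) < 1 := Real.exp_zero ▸ Real.exp_lt_exp.2 (by linarith)
    have hgap : r / 2 ≤ 1 - Real.exp (-r) := by
      have h1 : Real.exp (-r) * Real.exp r = 1 := by rw [← Real.exp_add]; simp
      nlinarith [Real.add_one_le_exp r]
    have hg : ∑ u ∈ Finset.range T, Real.exp (-r) ^ u ≤ 2 / r := by
      have h0 := Real.exp_pos (-r)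
      rw [geom_sum_eq hlt.ne, ← neg_div_neg_eq, neg_sub, neg_sub]
      calc (1 - Real.exp (-r) ^ T) / (1 - Real.exp (-r)) ≤ 1 / (r / 2) :=
            div_le_div₀ zero_le_one (by linarith [pow_pos h0 T]) (by linarith) hgap
        _ = 2 / r := by field_simp
    simp only [hq, ← Finset.mul_sum]
    calc Real.exp 1 * ∑ u ∈ Finset.range T, Real.exp (-r) ^ u ≤ 3 * (2 / r) :=
          mul_le_mul (by linarith [Real.exp_one_lt_d9]) hg
            (Finset.sum_nonneg fun u _ => (pow_pos (Real.exp_pos _) u).le) (by norm_num)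
      _ = 6 / r := by ring
  have hosc : ∀ x y, f x - f y ≤ 12 / r := fun x y => by
    calc f x - f y = ∑ u ∈ Finset.range T, ((P ^ u) x i - (P ^ u) y i) := by
          rw [Finset.sum_sub_distrib]
      _ ≤ ∑ u ∈ Finset.range T, 2 * Real.exp (1 - r * u) := Finset.sum_le_sum fun u _ => by
          have := (abs_le.1 (abs_sub_le_two_mul_dobrushin (P ^ u) x y i)).2
          linarith [hd u]
      _ ≤ 12 / r := by rw [← Finset.mul_sum]; linarith [show 2 * (6 / r) = 12 / r by ring]
  obtain ⟨y₀, -, hy₀⟩ := Finset.exists_min_image Finset.univ f Finset.univ_nonempty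
  refine ⟨fun x => f x - f y₀, fun x => sub_nonneg.2 (hy₀ x (Finset.mem_univ x)),
    fun x => hosc x y₀, fun x => ?_⟩
  have e1 : ∑ y, P x y * f y = ∑ u ∈ Finset.range T, (P ^ (u + 1)) x i := by
    simp only [hf, Finset.mul_sum]
    rw [Finset.sum_comm]
    exact Finset.sum_congr rfl fun u _ => by rw [pow_succ', Matrix.mul_apply]
  have e2 : ∑ u ∈ Finset.range T, (P ^ (u + 1)) x i = f x + (P ^ T) x i - (if x = i then 1 else 0) := by
    have h1 := Finset.sum_range_succ (fun u => (P ^ u) x i) T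
    have h2 := Finset.sum_range_succ' (fun u => (P ^ u) x i) T
    rw [pow_zero, Matrix.one_apply] at h2
    simp only [hf]
    linarith
  simp only [mul_sub, Finset.sum_sub_distrib, ← Finset.sum_mul, hP.2, e1, e2]
  linarith [hT x]

omit [Fintype Ω] [Nonempty Ω] in
lemma Nvisit_eq (s m : ℕ) (x : ℕ → Ω) (i : Ω) :
    Nvisit s (fun t : Fin (m + 1) => x t) i =
      ∑ k ∈ Finset.range (m / s), if x (s * k) = i then 1 else 0 := by
  rw [Finset.sum_range]
  unfold Nvisit
  refine Finset.sum_congr rfl fun k _ => ?_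
  have h1 : s * k.1 ≤ s * (m / s) := Nat.mul_le_mul_left s k.2.le
  have h2 := Nat.mul_div_le m s
  rw [dif_pos (by omega)]

omit [Fintype Ω] [Nonempty Ω] in
lemma Npair_eq (s m : ℕ) (x : ℕ → Ω) (i j : Ω) :
    Npair s (fun t : Fin (m + 1) => x t) i j =
      ∑ k ∈ Finset.range (m / s), if x (s * k) = i ∧ x (s * k + s) = j then 1 else 0 := by
  rw [Finset.sum_range]
  unfold Npair
  refine Finset.sum_congr rfl fun k _ => ?_
  have h1 : s * (k.1 + 1) ≤ s * (m / s) := Nat.mul_le_mul_left s k.2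
  have h2 := Nat.mul_div_le m s
  rw [mul_add, mul_one] at h1
  rw [dif_pos (by omega)]

omit [Fintype Ω] [DecidableEq Ω] [Nonempty Ω] in
lemma pathProb_nonneg {μ : Ω → ℝ} {M : Matrix Ω Ω ℝ} (hμ : ∀ i, 0 ≤ μ i) (hM : ∀ i j, 0 ≤ M i j)
    {m : ℕ} (x : Fin m → Ω) : 0 ≤ pathProb μ M x := by
  unfold pathProb
  split_ifs
  · exact zero_le_one
  · exact mul_nonneg (hμ _) (Finset.prod_nonneg fun _ _ => hM _ _)

omit [DecidableEq Ω] [Nonempty Ω] in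
lemma prTraj_univ {μ : Ω → ℝ} {M : Matrix Ω Ω ℝ} (hμ : IsDist μ) (hM : IsStochastic M) (m : ℕ) :
    prTraj μ M m Set.univ = 1 := by
  cases m with
  | zero => simp [prTraj, pathProb]
  | succ m =>
    have h := sum_pathProb_mul μ M m fun _ => 1
    simp only [mul_one, pathExp_one hM, hμ.2] at h
    simpa [prTraj] using h

omit [DecidableEq Ω] [Nonempty Ω] in
lemma prTraj_mono {μ : Ω → ℝ} {M : Matrix Ω Ω ℝ} (hμ : IsDist μ) (hM : IsStochastic M) {m : ℕ}
    {E F : Set (Fin m → Ω)} (h : E ⊆ F) : prTraj μ M m E ≤ prTraj μ M m F :=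
  Finset.sum_le_sum fun _ _ =>
    Set.indicator_le_indicator_of_subset h (fun y => pathProb_nonneg hμ.1 hM.1 y) _

omit [DecidableEq Ω] [Nonempty Ω] in
lemma prTraj_compl {μ : Ω → ℝ} {M : Matrix Ω Ω ℝ} (hμ : IsDist μ) (hM : IsStochastic M) {m : ℕ}
    (E : Set (Fin m → Ω)) : prTraj μ M m E = 1 - prTraj μ M m Eᶜ := by
  rw [eq_sub_iff_add_eq, ← prTraj_univ hμ hM m]
  unfold prTraj
  rw [← Finset.sum_add_distrib]
  exact Finset.sum_congr rfl fun x _ => by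
    rw [Set.indicator_univ, Set.indicator_self_add_compl_apply]

omit [DecidableEq Ω] [Nonempty Ω] in
lemma prTraj_biUnion_le {μ : Ω → ℝ} {M : Matrix Ω Ω ℝ} (hμ : IsDist μ) (hM : IsStochastic M)
    {m : ℕ} {ι : Type*} (S : Finset ι) (E : ι → Set (Fin m → Ω)) :
    prTraj μ M m (⋃ j ∈ S, E j) ≤ ∑ j ∈ S, prTraj μ M m (E j) := by
  unfold prTraj
  rw [Finset.sum_comm]
  refine Finset.sum_le_sum fun x _ => ?_
  have hn : ∀ j ∈ S, 0 ≤ (E j).indicator (pathProb μ M) x := fun j _ =>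
    Set.indicator_nonneg (fun y _ => pathProb_nonneg hμ.1 hM.1 y) x
  by_cases hx : x ∈ ⋃ j ∈ S, E j
  · obtain ⟨j, hj, hxj⟩ := Set.mem_iUnion₂.1 hx
    rw [Set.indicator_of_mem hx, ← Set.indicator_of_mem hxj (pathProb μ M)]
    exact Finset.single_le_sum hn hj
  · rw [Set.indicator_of_notMem hx]
    exact Finset.sum_nonneg hn

omit [DecidableEq Ω] [Nonempty Ω] in
/-- Markov's inequality along trajectories. -/
lemma prTraj_le_of_pathExp_le {μ : Ω → ℝ} {M : Matrix Ω Ω ℝ} (hμ : IsDist μ) (hM : IsStochastic M)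
    {m : ℕ} {E : Set (Fin (m + 1) → Ω)} (G : (ℕ → Ω) → ℝ) (hG : ∀ x, 0 ≤ G x)
    (hE : ∀ x : ℕ → Ω, (fun t : Fin (m + 1) => x t) ∈ E → 1 ≤ G x)
    {r : ℝ} (hr : ∀ a, pathExp M m a G ≤ r) : prTraj μ M (m + 1) E ≤ r := by
  have h1 : prTraj μ M (m + 1) E = ∑ x, pathProb μ M x * E.indicator (fun _ => 1) x :=
    Finset.sum_congr rfl fun x _ => by by_cases hx : x ∈ E <;> simp [hx]
  rw [h1, sum_pathProb_mul]
  calc ∑ a, μ a * pathExp M m a (fun x => E.indicator (fun _ => 1) fun t : Fin (m + 1) => x t)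
      ≤ ∑ a, μ a * r := by
        refine Finset.sum_le_sum fun a _ => mul_le_mul_of_nonneg_left ?_ (hμ.1 a)
        refine (pathExp_mono hM.1 m a fun x _ => ?_).trans (hr a)
        by_cases hx : (fun t : Fin (m + 1) => x t) ∈ E
        · rw [Set.indicator_of_mem hx]; exact hE x hx
        · rw [Set.indicator_of_notMem hx]; exact hG x
    _ = r := by rw [← Finset.sum_mul, hμ.2, one_mul]

omit [Nonempty Ω] in
/-- The `s`-skipped chain rarely visits `i` much less often than it should. -/
lemma prTraj_Nvisit_le {μ : Ω → ℝ} {M : Matrix Ω Ω ℝ} (hμ : IsDist μ) (hM : IsStochastic M)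
    {m s : ℕ} {i : Ω} {h : Ω → ℝ} {H q : ℝ} (hH : 0 < H) (hq : 0 ≤ q) (hq1 : q ≤ 1)
    (h0 : ∀ x, 0 ≤ h x) (hle : ∀ x, h x ≤ H)
    (hP : ∀ x, h x + q - (if x = i then 1 else 0) ≤ ∑ y, (M ^ s) x y * h y) :
    prTraj μ M (m + 1) {x | (Nvisit s x i : ℝ) ≤ ((m / s : ℕ) : ℝ) * q / 8} ≤
      2 * Real.exp (-(((m / s : ℕ) : ℝ) * q / (4 * H))) := by
  set n := m / s with hn
  let w : Ω → Ω → ℝ := fun a _ => Real.exp (-(2 / H) * if a = i then 1 else 0)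
  let V : Ω → ℝ := fun a => 2 * H - h a
  have hV1 : ∀ a, H ≤ V a := fun a => by simp only [V]; linarith [hle a]
  have hV2 : ∀ a, V a ≤ 2 * H := fun a => by simp only [V]; linarith [h0 a]
  have hstep : ∀ a, ∑ b, (M ^ s) a b * (w a b * V b) ≤ Real.exp (-(q / (2 * H))) * V a := by
    intro a
    have e : ∑ b, (M ^ s) a b * (w a b * V b) = w a a * (2 * H - ∑ b, (M ^ s) a b * h b) := by
      have : ∑ b, (M ^ s) a b * (w a b * V b) =
          w a a * (2 * H * ∑ b, (M ^ s) a b - ∑ b, (M ^ s) a b * h b) := by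
        rw [Finset.mul_sum, ← Finset.sum_sub_distrib, Finset.mul_sum]
        exact Finset.sum_congr rfl fun b _ => by simp only [w, V]; ring
      rw [this, (hM.pow s).2, mul_one]
    rw [e]
    have hPa := hP a
    have hVa : 0 < V a := hH.trans_le (hV1 a)
    by_cases ha : a = i
    · simp only [w, if_pos ha, mul_one] at hPa ⊢
      have h1 : 2 * H - ∑ b, (M ^ s) a b * h b ≤ V a * Real.exp (1 / H) := by
        have : V a + 1 ≤ V a * (1 / H + 1) := by
          have : 1 ≤ V a * (1 / H) := by
            rw [mul_one_div, le_div_iff₀ hH]; linarith [hV1 a]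
          linarith
        have h3 := mul_le_mul_of_nonneg_left (Real.add_one_le_exp (1 / H)) hVa.le
        simp only [V] at *
        linarith
      calc Real.exp (-(2 / H)) * (2 * H - ∑ b, (M ^ s) a b * h b)
          ≤ Real.exp (-(2 / H)) * (V a * Real.exp (1 / H)) :=
            mul_le_mul_of_nonneg_left h1 (Real.exp_pos _).le
        _ = Real.exp (-(1 / H)) * V a := by
            rw [mul_left_comm, ← Real.exp_add, mul_comm]; congr 2; ring
        _ ≤ Real.exp (-(q / (2 * H))) * V a := by
            refine mul_le_mul_of_nonneg_right (Real.exp_le_exp.2 (neg_le_neg ?_)) hVa.le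
            exact div_le_div₀ zero_le_one hq1 hH (by linarith)
    · simp only [w, if_neg ha, mul_zero, Real.exp_zero, one_mul, sub_zero] at hPa ⊢
      have h1 : V a * (q / (2 * H)) ≤ q := by
        rw [← mul_div_assoc, div_le_iff₀ (by linarith), mul_comm]
        exact mul_le_mul_of_nonneg_left (hV2 a) hq
      have h2 := mul_le_mul_of_nonneg_right (Real.add_one_le_exp (-(q / (2 * H)))) hVa.le
      simp only [V] at *
      linarith
  set L : ℝ := 1 / H * Real.exp ((n : ℝ) * q / (4 * H)) with hL
  have hL0 : 0 < L := mul_pos (by positivity) (Real.exp_pos _)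
  refine prTraj_le_of_pathExp_le hμ hM (fun x => L *
    ((∏ k ∈ Finset.range n, w (x (s * k)) (x (s * k + s))) * V (x (s * n))))
    (fun x => mul_nonneg hL0.le (mul_nonneg (Finset.prod_nonneg fun _ _ => (Real.exp_pos _).le)
      (hH.le.trans (hV1 _)))) (fun x hx => ?_) fun a => ?_
  · rw [Set.mem_ofPred_eq, Nvisit_eq] at hx
    push_cast at hx
    have e : ∏ k ∈ Finset.range n, w (x (s * k)) (x (s * k + s)) =
        Real.exp (-(2 / H) * ∑ k ∈ Finset.range n, if x (s * k) = i then (1 : ℝ) else 0) := by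
      rw [Finset.mul_sum, Real.exp_sum]
    have h1 : Real.exp (-((n : ℝ) * q / (4 * H))) ≤
        ∏ k ∈ Finset.range n, w (x (s * k)) (x (s * k + s)) := by
      rw [e, Real.exp_le_exp]
      have := mul_le_mul_of_nonneg_left hx (show 0 ≤ 2 / H by positivity)
      have e2 : 2 / H * ((n : ℝ) * q / 8) = (n : ℝ) * q / (4 * H) := by field_simp; ring
      rw [e2] at this
      rw [neg_mul]
      exact neg_le_neg this
    calc (1 : ℝ) = L * (Real.exp (-((n : ℝ) * q / (4 * H))) * H) := by
          rw [hL, Real.exp_neg]; field_simp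
      _ ≤ _ := mul_le_mul_of_nonneg_left
          (mul_le_mul h1 (hV1 _) hH.le ((Real.exp_pos _).le.trans h1)) hL0.le
  · rw [pathExp_const_mul]
    have h1 := pathExp_prod_le hM w (fun _ _ => (Real.exp_pos _).le) V (Real.exp_pos _).le hstep
      (hM.pow s).1 n m (Nat.mul_div_le m s) a
    calc _ ≤ L * (Real.exp (-(q / (2 * H))) ^ n * (2 * H)) :=
          mul_le_mul_of_nonneg_left (h1.trans (mul_le_mul_of_nonneg_left (hV2 a)
            (pow_pos (Real.exp_pos _) n).le)) hL0.le
      _ = 2 * (Real.exp ((n : ℝ) * q / (4 * H)) * Real.exp (n * -(q / (2 * H)))) := by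
          rw [← Real.exp_nat_mul, hL]; field_simp
      _ = _ := by rw [← Real.exp_add]; congr 2; field_simp; ring

omit [DecidableEq Ω] [Nonempty Ω] in
/-- A Hoeffding-type bound for the moment generating function of a bounded variable. -/
lemma sum_mul_exp_le {p σ : Ω → ℝ} (hp : IsDist p) (hσ : ∀ j, |σ j| ≤ 1) {l : ℝ} (hl : 0 ≤ l)
    (hl1 : l ≤ 1 / 2) :
    ∑ b, p b * Real.exp (l * (σ b - ∑ j, p j * σ j) - l ^ 2) ≤ 1 := by
  set e := ∑ j, p j * σ j with he
  have hq : ∑ b, p b * (σ b - e) ^ 2 ≤ 1 := by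
    have h1 : ∑ b, p b * (σ b - e) ^ 2 = ∑ b, p b * σ b ^ 2 - e ^ 2 := by
      have : ∀ b, p b * (σ b - e) ^ 2 = p b * σ b ^ 2 - 2 * e * (p b * σ b) + e ^ 2 * p b :=
        fun b => by ring
      simp only [this, Finset.sum_add_distrib, Finset.sum_sub_distrib, ← Finset.mul_sum, hp.2, ← he]
      ring
    have h2 : ∑ b, p b * σ b ^ 2 ≤ ∑ b, p b * 1 := Finset.sum_le_sum fun b _ =>
      mul_le_mul_of_nonneg_left ((sq_le_one_iff_abs_le_one _).2 (hσ b)) (hp.1 b)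
    simp only [mul_one, hp.2] at h2
    nlinarith [sq_nonneg e]
  have hele : |e| ≤ 1 := by
    refine (Finset.abs_sum_le_sum_abs _ _).trans ?_
    rw [← hp.2]
    refine Finset.sum_le_sum fun b _ => ?_
    rw [abs_mul, abs_of_nonneg (hp.1 b)]
    exact mul_le_of_le_one_right (hp.1 b) (hσ b)
  have hb : ∀ b, Real.exp (l * (σ b - e)) ≤ 1 + l * (σ b - e) + l ^ 2 * (σ b - e) ^ 2 := fun b => by
    have h1 : |σ b - e| ≤ 2 := (abs_sub _ _).trans (by linarith [hσ b])
    have h2 := Real.abs_exp_sub_one_sub_id_le (x := l * (σ b - e)) (by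
      rw [abs_mul, abs_of_nonneg hl]; nlinarith [abs_nonneg (σ b - e)])
    have := (abs_le.1 h2).2
    rw [mul_pow] at this
    linarith
  have h0 : ∑ b, p b * (σ b - e) = 0 := by
    simp only [mul_sub, Finset.sum_sub_distrib, ← Finset.sum_mul, hp.2, ← he]; ring
  have hmain : ∑ b, p b * Real.exp (l * (σ b - e)) ≤ Real.exp (l ^ 2) :=
    calc ∑ b, p b * Real.exp (l * (σ b - e))
        ≤ ∑ b, p b * (1 + l * (σ b - e) + l ^ 2 * (σ b - e) ^ 2) :=
          Finset.sum_le_sum fun b _ => mul_le_mul_of_nonneg_left (hb b) (hp.1 b)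
      _ = ∑ b, p b + l * ∑ b, p b * (σ b - e) + l ^ 2 * ∑ b, p b * (σ b - e) ^ 2 := by
          simp only [Finset.mul_sum, ← Finset.sum_add_distrib]
          exact Finset.sum_congr rfl fun b _ => by ring
      _ ≤ Real.exp (l ^ 2) := by
          rw [h0, hp.2]
          nlinarith [Real.add_one_le_exp (l ^ 2), sq_nonneg l]
  simp only [Real.exp_sub _ (l ^ 2), ← mul_div_assoc, ← Finset.sum_div]
  exact (div_le_one (Real.exp_pos _)).2 hmain

omit [Nonempty Ω] in
/-- Self-normalized deviation bound for the observed transitions out of `i`. -/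
lemma prTraj_deviation_le {μ : Ω → ℝ} {M : Matrix Ω Ω ℝ} (hμ : IsDist μ) (hM : IsStochastic M)
    {m s : ℕ} {i : Ω} {σ : Ω → ℝ} (hσ : ∀ j, |σ j| ≤ 1) {a n₀ : ℝ} (ha : 0 ≤ a) (ha1 : a ≤ 1) :
    prTraj μ M (m + 1) {x | n₀ ≤ Nvisit s x i ∧
      a * Nvisit s x i ≤ ∑ j, σ j * (Npair s x i j - Nvisit s x i * (M ^ s) i j)} ≤
      Real.exp (-(a ^ 2 * n₀ / 4)) := by
  set n := m / s with hn
  set e := ∑ j, (M ^ s) i j * σ j with he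
  let w : Ω → Ω → ℝ := fun u v =>
    Real.exp (if u = i then a / 2 * (σ v - e) - (a / 2) ^ 2 else 0)
  have hstep : ∀ u, ∑ b, (M ^ s) u b * (w u b * 1) ≤ 1 * 1 := by
    intro u
    by_cases hu : u = i
    · subst hu
      simp only [w, if_true, mul_one]
      exact sum_mul_exp_le ⟨(hM.pow s).1 u, (hM.pow s).2 u⟩ hσ (by linarith) (by linarith)
    · simp only [w, if_neg hu, Real.exp_zero, mul_one, (hM.pow s).2, le_refl]
  refine prTraj_le_of_pathExp_le hμ hM (fun x => Real.exp (-(a ^ 2 * n₀ / 4)) *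
    ((∏ k ∈ Finset.range n, w (x (s * k)) (x (s * k + s))) * 1))
    (fun x => mul_nonneg (Real.exp_pos _).le (mul_nonneg
      (Finset.prod_nonneg fun _ _ => (Real.exp_pos _).le) zero_le_one)) (fun x hx => ?_) fun b => ?_
  · obtain ⟨hx1, hx2⟩ := hx
    have e1 : ∑ j, σ j * ((Npair s (fun t : Fin (m + 1) => x t) i j : ℝ) -
        Nvisit s (fun t : Fin (m + 1) => x t) i * (M ^ s) i j) =
        ∑ k ∈ Finset.range n, if x (s * k) = i then σ (x (s * k + s)) - e else 0 := by
      have h1 : ∀ k, (if x (s * k) = i then σ (x (s * k + s)) - e else 0) =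
          ∑ j, σ j * ((if x (s * k) = i ∧ x (s * k + s) = j then (1 : ℝ) else 0) -
            (if x (s * k) = i then (1 : ℝ) else 0) * (M ^ s) i j) := fun k => by
        by_cases hk : x (s * k) = i
        · simp only [hk, true_and, if_true, mul_sub, Finset.sum_sub_distrib, one_mul, he]
          simp [mul_comm]
        · simp [hk]
      simp only [h1]
      rw [Finset.sum_comm]
      refine Finset.sum_congr rfl fun j _ => ?_
      rw [Nvisit_eq, Npair_eq, ← Finset.mul_sum, Finset.sum_sub_distrib, ← Finset.sum_mul]
      push_cast
      rfl
    have e2 : ∏ k ∈ Finset.range n, w (x (s * k)) (x (s * k + s)) =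
        Real.exp (a / 2 * (∑ k ∈ Finset.range n, if x (s * k) = i then σ (x (s * k + s)) - e else 0)
          - (a / 2) ^ 2 * Nvisit s (fun t : Fin (m + 1) => x t) i) := by
      rw [Nvisit_eq]
      push_cast
      rw [Finset.mul_sum, Finset.mul_sum, ← Finset.sum_sub_distrib, Real.exp_sum]
      refine Finset.prod_congr rfl fun k _ => ?_
      by_cases hk : x (s * k) = i <;> simp [w, hk]
    rw [e1] at hx2
    rw [mul_one, e2, ← Real.exp_add]
    refine Real.one_le_exp ?_
    have h1 := mul_le_mul_of_nonneg_left hx1 (sq_nonneg a)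
    have h2 := mul_le_mul_of_nonneg_left hx2 (show 0 ≤ a / 2 by linarith)
    linarith
  · rw [pathExp_const_mul]
    have h1 := pathExp_prod_le hM w (fun _ _ => (Real.exp_pos _).le) (fun _ => 1) zero_le_one hstep
      (hM.pow s).1 n m (Nat.mul_div_le m s) b
    rw [one_pow, one_mul] at h1
    exact mul_le_of_le_one_right (Real.exp_pos _).le h1

omit [DecidableEq Ω] in
lemma dobrushin_le_add {A B : Matrix Ω Ω ℝ} {a : ℝ} (h : ∀ i, ∑ j, |A i j - B i j| ≤ a) :
    dobrushin A ≤ dobrushin B + a := by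
  refine dobrushin_le fun i j => ?_
  have h1 := tvDist_le_dobrushin B i j
  have h2 : ∑ x, |A i x - A j x| ≤
      ∑ x, (|A i x - B i x| + |B i x - B j x| + |A j x - B j x|) :=
    Finset.sum_le_sum fun x _ => by
      rw [abs_sub_comm (A j x)]
      exact (abs_sub_le _ (B j x) _).trans (add_le_add_left (abs_sub_le _ (B i x) _) _)
  simp only [Finset.sum_add_distrib] at h2
  unfold tvDist at *
  linarith [h i, h j]

omit [DecidableEq Ω] in
lemma abs_dobrushin_sub_le {A B : Matrix Ω Ω ℝ} {a : ℝ} (h : ∀ i, ∑ j, |A i j - B i j| ≤ a) :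
    |dobrushin A - dobrushin B| ≤ a := by
  have h1 := dobrushin_le_add h
  have h2 := dobrushin_le_add (A := B) (B := A) (a := a) fun i => by
    simpa only [abs_sub_comm] using h i
  rw [abs_le]
  constructor <;> linarith

/-- The sign vector encoded by a Boolean vector. -/
def signVec (b : Ω → Bool) (j : Ω) : ℝ := if b j then 1 else -1

omit [Nonempty Ω] in
lemma sum_abs_empMat_sub_le {s m : ℕ} {x : Fin m → Ω} {i : Ω} {p : Ω → ℝ} {a : ℝ}
    (hN : 0 < Nvisit s x i)
    (h : ∀ b : Ω → Bool, ∑ j, signVec b j * (Npair s x i j - Nvisit s x i * p j) <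
      a * Nvisit s x i) :
    ∑ j, |empMat s x i j - p j| ≤ a := by
  have hN' : (0 : ℝ) < Nvisit s x i := by exact_mod_cast hN
  have h1 := h fun j => decide (0 ≤ (Npair s x i j : ℝ) - Nvisit s x i * p j)
  have e : ∀ j, signVec (fun j => decide (0 ≤ (Npair s x i j : ℝ) - Nvisit s x i * p j)) j *
      (Npair s x i j - Nvisit s x i * p j) = Nvisit s x i * |empMat s x i j - p j| := fun j => by
    have e1 : empMat s x i j - p j = (Npair s x i j - Nvisit s x i * p j) / Nvisit s x i := by
      rw [empMat, Matrix.of_apply, if_pos hN]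
      field_simp
    rw [e1, abs_div, abs_of_pos hN', mul_div_cancel₀ _ hN'.ne']
    by_cases h0 : 0 ≤ (Npair s x i j : ℝ) - Nvisit s x i * p j
    · simp only [signVec, h0, decide_true, if_true, one_mul, abs_of_nonneg h0]
    · rw [abs_of_neg (not_le.1 h0)]
      simp [signVec, h0]
  simp only [e, ← Finset.mul_sum] at h1
  rw [mul_comm] at h1
  exact (lt_of_mul_lt_mul_right h1 hN'.le).le

/-- Concentration of one row of the empirical `s`-step transition matrix. -/
lemma prTraj_row_le {μ π : Ω → ℝ} {M : Matrix Ω Ω ℝ} (hM : IsStochastic M) (hμ : IsDist μ)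
    (hπ : IsDist π) (hs : Matrix.vecMul π M = π) {m s : ℕ} {g p ε L : ℝ} (i : Ω)
    (hg : 0 < g) (hg1 : g ≤ 1) (hp : 0 < p) (hpi : p ≤ π i) (hε : 0 < ε) (hε1 : ε < 1) (hL : 1 ≤ L)
    (hs0 : 0 < s) (hsg : g * s ≤ 2) (hms : 2 * s ≤ m + 1)
    (hd : ∀ n : ℕ, dobrushin (M ^ n) ≤ Real.exp (1 - g / 2 * n))
    (hm : 2560 * (Fintype.card Ω * L) ≤ (m + 1 : ℝ) * p * g ^ 2 * ε ^ 2) :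
    prTraj μ M (m + 1) {x | ε * g * s / 2 < ∑ j, |empMat s x i j - (M ^ s) i j|} ≤
      3 * Real.exp (-(4 * L)) := by
  have hs0' : (1 : ℝ) ≤ s := by exact_mod_cast hs0
  have hgs : 0 < g * s := by positivity
  have hcard : (1 : ℝ) ≤ Fintype.card Ω := by exact_mod_cast Fintype.card_pos
  obtain ⟨h, h0, hH, hP⟩ := exists_poisson (hM.pow s) hπ (vecMul_pow_eq hs s)
    (r := g * s / 2) (by positivity) (by linarith) (fun n => by
      rw [← pow_mul]
      refine (hd _).trans (le_of_eq ?_)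
      push_cast; ring_nf) i (hp.trans_le hpi)
  have hπ1 : π i ≤ 1 := by
    rw [← hπ.2]; exact Finset.single_le_sum (fun j _ => hπ.1 j) (Finset.mem_univ i)
  have hπ0 : 0 < π i := hp.trans_le hpi
  set n := m / s with hn
  have hns : (m + 1 : ℝ) ≤ 2 * (n * s) := by
    have h1 := Nat.div_add_mod m s
    have h2 := Nat.mod_lt m hs0
    rw [← hn] at h1
    have : m + 1 ≤ 2 * (s * n) := by omega
    have h3 : ((m + 1 : ℕ) : ℝ) ≤ ((2 * (s * n) : ℕ) : ℝ) := by exact_mod_cast this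
    push_cast at h3; linarith
  have hV := prTraj_Nvisit_le hμ hM (m := m) (s := s) (i := i) (h := h) (H := 12 / (g * s / 2))
    (q := π i / 2) (by positivity) (by linarith) (by linarith) h0 hH hP
  have hD := fun b : Ω → Bool => prTraj_deviation_le hμ hM (m := m) (s := s) (i := i)
    (σ := signVec b) (fun j => by unfold signVec; split_ifs <;> norm_num) (a := ε * g * s / 2)
    (n₀ := n * (π i / 2) / 8) (by positivity) (by nlinarith)
  rw [← hn] at hV
  let E : Option (Ω → Bool) → Set (Fin (m + 1) → Ω) := fun o => o.elim
    {x | (Nvisit s x i : ℝ) ≤ n * (π i / 2) / 8}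
    fun b => {x | n * (π i / 2) / 8 ≤ (Nvisit s x i : ℝ) ∧ ε * g * s / 2 * Nvisit s x i ≤
      ∑ j, signVec b j * (Npair s x i j - Nvisit s x i * (M ^ s) i j)}
  have hsub : {x : Fin (m + 1) → Ω | ε * g * s / 2 < ∑ j, |empMat s x i j - (M ^ s) i j|} ⊆
      ⋃ o ∈ Finset.univ, E o := by
    intro x hx
    by_contra hx'
    simp only [Set.mem_iUnion, Finset.mem_univ, exists_prop, true_and,
      not_exists] at hx'
    have hv : ¬ (Nvisit s x i : ℝ) ≤ n * (π i / 2) / 8 := hx' none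
    rw [not_le] at hv
    have hx2 : ∑ j, |empMat s x i j - (M ^ s) i j| ≤ ε * g * s / 2 := by
      refine sum_abs_empMat_sub_le ?_ fun b => ?_
      · have : (0 : ℝ) < Nvisit s x i := lt_of_le_of_lt (by positivity) hv
        exact_mod_cast this
      · by_contra! hb
        exact hx' (some b) ⟨hv.le, hb⟩
    exact absurd hx (not_lt.2 hx2)
  have hA : 4 * L ≤ n * (π i / 2) / (4 * (12 / (g * s / 2))) := by
    have e : n * (π i / 2) / (4 * (12 / (g * s / 2))) = (n * s) * (π i * g) / 192 := by
      field_simp; ring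
    rw [e]
    have h1 : (m + 1 : ℝ) * (p * g) ≤ 2 * (n * s) * (π i * g) :=
      mul_le_mul hns (mul_le_mul_of_nonneg_right hpi hg.le) (by positivity) (by positivity)
    have h2 : (m + 1 : ℝ) * p * g ^ 2 * ε ^ 2 ≤ (m + 1 : ℝ) * (p * g) := by
      have : g * ε ^ 2 ≤ 1 := mul_le_one₀ hg1 (sq_nonneg ε) (pow_le_one₀ hε.le hε1.le)
      have h4 : (0 : ℝ) ≤ (m + 1 : ℝ) * (p * g) := by positivity
      nlinarith
    nlinarith
  have hB : 5 * (Fintype.card Ω * L) ≤ (ε * g * s / 2) ^ 2 * (n * (π i / 2) / 8) / 4 := by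
    have e : (ε * g * s / 2) ^ 2 * (n * (π i / 2) / 8) / 4 =
      (n * s) * π i * (g ^ 2 * ε ^ 2) * s / 256 := by ring
    rw [e]
    have h1 : (m + 1 : ℝ) * p ≤ 2 * (n * s) * π i :=
      mul_le_mul hns hpi hp.le (by positivity)
    have h2 := mul_le_mul_of_nonneg_right h1 (show 0 ≤ g ^ 2 * ε ^ 2 by positivity)
    have h3 : (n * s) * π i * (g ^ 2 * ε ^ 2) ≤ (n * s) * π i * (g ^ 2 * ε ^ 2) * s :=
      le_mul_of_one_le_right (by positivity) hs0'
    linarith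
  have h2d : (2 : ℝ) ^ Fintype.card Ω ≤ Real.exp (Fintype.card Ω * L) := by
    rw [Real.exp_nat_mul]
    exact pow_le_pow_left₀ zero_le_two (by linarith [Real.add_one_le_exp L]) _
  calc _ ≤ ∑ o, prTraj μ M (m + 1) (E o) :=
        (prTraj_mono hμ hM hsub).trans (prTraj_biUnion_le hμ hM _ _)
    _ ≤ 2 * Real.exp (-(4 * L)) + ∑ _b : Ω → Bool, Real.exp (-(5 * (Fintype.card Ω * L))) := by
        rw [Fintype.sum_option]
        exact add_le_add
          (hV.trans (mul_le_mul_of_nonneg_left (Real.exp_le_exp.2 (neg_le_neg hA)) zero_le_two))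
          (Finset.sum_le_sum fun b _ => (hD b).trans (Real.exp_le_exp.2 (neg_le_neg hB)))
    _ ≤ 2 * Real.exp (-(4 * L)) + Real.exp (-(4 * L)) := by
        refine add_le_add_right ?_ _
        simp only [Finset.sum_const, Finset.card_univ, nsmul_eq_mul, Fintype.card_fun,
          Fintype.card_bool, Nat.cast_pow, Nat.cast_ofNat]
        refine (mul_le_mul_of_nonneg_right h2d (Real.exp_pos _).le).trans ?_
        rw [← Real.exp_add, Real.exp_le_exp]
        nlinarith
    _ = _ := by ring

/-- Plug-in estimator of `1 - genCC M`. -/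
noncomputable def gapEst {m : ℕ} (x : Fin m → Ω) : ℝ :=
  (Finset.range (m + 1)).sup' Finset.nonempty_range_add_one fun k =>
    (1 - dobrushin (empMat (k + 1) x)) / ((k + 1 : ℕ) : ℝ)

/-- Estimator of `genCC M`, shrunk so that it takes values in `(0, 1)`. -/
noncomputable def genCCEst (ε : ℝ) {m : ℕ} (x : Fin m → Ω) : ℝ :=
  if 0 < gapEst x then 1 - (1 - ε / 8) * gapEst x else 1 / 2

lemma gapEst_le_one {m : ℕ} (x : Fin m → Ω) : gapEst x ≤ 1 := by
  refine Finset.sup'_le _ _ fun k _ => ?_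
  have : (1 : ℝ) ≤ ((k + 1 : ℕ) : ℝ) := by exact_mod_cast Nat.le_add_left 1 k
  exact (div_le_one (by linarith)).2 (by linarith [dobrushin_nonneg (empMat (k + 1) x)])

lemma genCCEst_mem {ε : ℝ} (hε : ε ∈ Set.Ioo (0 : ℝ) 1) {m : ℕ} (x : Fin m → Ω) :
    genCCEst ε x ∈ Set.Ioo (0 : ℝ) 1 := by
  unfold genCCEst
  have h1 := gapEst_le_one x
  have h2 := hε.1
  have h3 := hε.2
  split_ifs with h
  · constructor <;> nlinarith
  · norm_num

lemma abs_genCCEst_lt {ε : ℝ} (hε : ε ∈ Set.Ioo (0 : ℝ) 1) {M : Matrix Ω Ω ℝ}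
    (hg : 0 < 1 - genCC M) {m : ℕ} (hm : 2 / (1 - genCC M) ≤ m + 1)
    (x : Fin m → Ω)
    (h : ∀ s : ℕ, 0 < s → (1 - genCC M) * s ≤ 2 →
      |dobrushin (empMat s x) - dobrushin (M ^ s)| ≤ ε * (1 - genCC M) * s / 2) :
    |(1 - genCCEst ε x) / (1 - genCC M) - 1| < ε := by
  obtain ⟨hε0, hε1⟩ := hε
  set g := 1 - genCC M with hgdef
  have hup : gapEst x ≤ g * (1 + ε / 2) := by
    refine Finset.sup'_le _ _ fun k _ => ?_
    have hk : (0 : ℝ) < ((k + 1 : ℕ) : ℝ) := by positivity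
    rw [div_le_iff₀ hk]
    by_cases hks : g * ((k + 1 : ℕ) : ℝ) ≤ 2
    · have h1 := (abs_le.1 (h (k + 1) k.succ_pos hks)).1
      have h2 := div_le_one_sub_genCC M k.succ_pos
      rw [div_le_iff₀ hk, ← hgdef] at h2
      linarith
    · have := dobrushin_nonneg (empMat (k + 1) x)
      nlinarith
  have hlow : g * (1 - 3 * ε / 4) < gapEst x := by
    obtain ⟨s, hs, h1⟩ := exists_lt_of_lt_one_sub_genCC M (r := g * (1 - ε / 4)) (by
      rw [← hgdef]; nlinarith)
    have hs' : (0 : ℝ) < s := by exact_mod_cast hs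
    rw [lt_div_iff₀ hs'] at h1
    have hgs : 0 < g * s := by positivity
    have hsg : g * s ≤ 2 := by nlinarith [dobrushin_nonneg (M ^ s)]
    have h2 := (abs_le.1 (h s hs hsg)).2
    have hsm : s ≤ m + 1 := by
      have : (s : ℝ) ≤ m + 1 := le_trans (by rw [le_div_iff₀ hg]; linarith) hm
      exact_mod_cast this
    obtain ⟨k, rfl⟩ : ∃ k, s = k + 1 := ⟨s - 1, by omega⟩
    refine lt_of_lt_of_le ?_ (Finset.le_sup' (fun k : ℕ =>
      (1 - dobrushin (empMat (k + 1) x)) / ((k + 1 : ℕ) : ℝ))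
      (Finset.mem_range.2 (show k < m + 1 by omega)))
    rw [lt_div_iff₀ hs']
    linarith
  have hpos : 0 < gapEst x := lt_trans (mul_pos hg (by linarith)) hlow
  rw [genCCEst, if_pos hpos, sub_sub_cancel, abs_lt, lt_sub_iff_add_lt, sub_lt_iff_lt_add,
    lt_div_iff₀ hg, div_lt_iff₀ hg]
  have h1 := mul_lt_mul_of_pos_left hlow (show 0 < 1 - ε / 8 by linarith)
  have h2 := mul_le_mul_of_nonneg_left hup (show 0 ≤ 1 - ε / 8 by linarith)
  have h3 : 0 < g * ε := mul_pos hg hε0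
  have h4 : 0 < g * ε * ε := mul_pos h3 hε0
  constructor <;> nlinarith

lemma prTraj_genCCEst_ge {ε δ : ℝ} (hε : ε ∈ Set.Ioo (0 : ℝ) 1) (hδ : δ ∈ Set.Ioo (0 : ℝ) 1)
    {M : Matrix Ω Ω ℝ} {μ π : Ω → ℝ} (hM : IsStochastic M) (hE : IsErgodic M) (hμ : IsDist μ)
    (hπ : IsDist π) (hs : Matrix.vecMul π M = π) {m : ℕ} {R : ℝ} (hR : 4 ≤ R)
    (hRδ : Fintype.card Ω ≤ R * δ * (1 - genCC M))
    (hm : 2560 * (Fintype.card Ω * Real.log R) ≤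
      (m : ℝ) * piMinOf π * (1 - genCC M) ^ 2 * ε ^ 2) :
    1 - δ ≤ prTraj μ M m {x | |(1 - genCCEst ε x) / (1 - genCC M) - 1| < ε} := by
  have hg := one_sub_genCC_pos hM hE
  have hg1 := one_sub_genCC_le_one M
  have hp := piMinOf_pos hE hπ hs
  set g := 1 - genCC M with hgdef
  have hcard : (1 : ℝ) ≤ Fintype.card Ω := by exact_mod_cast Fintype.card_pos
  have hL : 1 ≤ Real.log R := by
    rw [Real.le_log_iff_exp_le (by linarith)]
    linarith [Real.exp_one_lt_d9]
  obtain ⟨hε0, hε1⟩ := hε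
  have hp1 : piMinOf π ≤ 1 := by
    have := card_mul_piMinOf_le hπ
    nlinarith
  have hmg : 2560 ≤ (m : ℝ) * g := by
    have h1 : piMinOf π * g * ε ^ 2 ≤ 1 :=
      mul_le_one₀ (mul_le_one₀ hp1 hg.le hg1) (sq_nonneg ε) (pow_le_one₀ hε0.le hε1.le)
    have h2 : 0 ≤ (m : ℝ) * g := by positivity
    nlinarith
  obtain ⟨m, rfl⟩ : ∃ m', m = m' + 1 := Nat.exists_eq_succ_of_ne_zero fun h0 => by
    rw [h0, Nat.cast_zero, zero_mul] at hmg; linarith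
  push_cast at hm hmg
  obtain ⟨s₀, hs₀, hs₀g⟩ := exists_lt_of_lt_one_sub_genCC M (r := g / 2) (by linarith)
  have hs₀' : (0 : ℝ) < s₀ := by exact_mod_cast hs₀
  rw [lt_div_iff₀ hs₀'] at hs₀g
  have hd := dobrushin_pow_le_exp hM hs₀ (r := g / 2) (by linarith) (by linarith)
  set S := Finset.Icc 1 ⌊2 / g⌋₊ with hS
  have hmemS : ∀ s : ℕ, s ∈ S ↔ 0 < s ∧ g * s ≤ 2 := fun s => by
    rw [hS, Finset.mem_Icc, Nat.le_floor_iff (by positivity), le_div_iff₀ hg, mul_comm]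
    rfl
  let E : ℕ × Ω → Set (Fin (m + 1) → Ω) := fun t =>
    {x | ε * g * t.1 / 2 < ∑ j, |empMat t.1 x t.2 j - (M ^ t.1) t.2 j|}
  have hsub : {x : Fin (m + 1) → Ω | |(1 - genCCEst ε x) / g - 1| < ε}ᶜ ⊆
      ⋃ t ∈ S ×ˢ Finset.univ, E t := by
    intro x hx
    by_contra hx'
    refine hx (abs_genCCEst_lt ⟨hε0, hε1⟩ hg ?_ x fun s h0 hsg => ?_)
    · rw [← hgdef, div_le_iff₀ hg]; push_cast; linarith
    · refine abs_dobrushin_sub_le fun i => ?_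
      by_contra! hi
      exact hx' (Set.mem_iUnion₂.2 ⟨(s, i), Finset.mem_product.2
        ⟨(hmemS s).2 ⟨h0, hsg⟩, Finset.mem_univ i⟩, hi⟩)
  have hbad : ∀ t ∈ S ×ˢ (Finset.univ : Finset Ω), prTraj μ M (m + 1) (E t) ≤
      3 * Real.exp (-(4 * Real.log R)) := by
    rintro ⟨s, i⟩ ht
    obtain ⟨h0, hsg⟩ := (hmemS s).1 (Finset.mem_product.1 ht).1
    refine prTraj_row_le hM hμ hπ hs i hg hg1 hp (piMinOf_le π i) hε0 hε1 hL h0 hsg ?_ hd hm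
    have : (2 * s : ℝ) ≤ m + 1 := by
      by_contra! hc
      nlinarith
    exact_mod_cast this
  have hcardS : ((S ×ˢ (Finset.univ : Finset Ω)).card : ℝ) * g ≤ 2 * Fintype.card Ω := by
    rw [Finset.card_product, hS, Nat.card_Icc, Nat.add_sub_cancel, Finset.card_univ]
    push_cast
    have := Nat.floor_le (show 0 ≤ 2 / g by positivity)
    rw [le_div_iff₀ hg] at this
    nlinarith
  have hexp : Real.exp (-(4 * Real.log R)) * R ^ 4 = 1 := by
    rw [← Real.exp_log (show 0 < R by linarith), ← Real.exp_nat_mul, Real.log_exp,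
      ← Real.exp_add]
    simp
  rw [prTraj_compl hμ hM]
  have hfin : ∑ t ∈ S ×ˢ (Finset.univ : Finset Ω), prTraj μ M (m + 1) (E t) ≤ δ := by
    refine (Finset.sum_le_sum hbad).trans ?_
    rw [Finset.sum_const, nsmul_eq_mul]
    set N : ℝ := ((S ×ˢ (Finset.univ : Finset Ω)).card : ℝ)
    set e := Real.exp (-(4 * Real.log R))
    have he : 0 < e := Real.exp_pos _
    have hN : N ≤ 2 * (R * δ) := by
      refine le_of_mul_le_mul_right (hcardS.trans ?_) hg
      linarith
    have hR3 : (64 : ℝ) ≤ R ^ 3 := by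
      have := pow_le_pow_left₀ (by norm_num) hR 3
      linarith
    have heR : 0 ≤ e * R := mul_nonneg he.le (by linarith)
    have h64 : e * R * 64 ≤ 1 := by
      calc e * R * 64 ≤ e * R * R ^ 3 := mul_le_mul_of_nonneg_left hR3 heR
        _ = e * R ^ 4 := by ring
        _ = 1 := hexp
    calc N * (3 * e) ≤ 2 * (R * δ) * (3 * e) := mul_le_mul_of_nonneg_right hN (by linarith)
      _ = δ * (6 * (e * R)) := by ring
      _ ≤ δ := mul_le_of_le_one_right hδ.1.le (by linarith)
  linarith [(prTraj_mono hμ hM hsub).trans (prTraj_biUnion_le hμ hM _ E)]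

/-- point estimator for `1 − κ̃` with relative error `ε`
(Theorem 4 of the paper). -/
theorem point_estimator_relative :
    ∃ c : ℝ, 0 < c ∧ ∃ c' : ℝ, 0 < c' ∧
      ∀ (ε δ : ℝ), ε ∈ Set.Ioo (0 : ℝ) 1 → δ ∈ Set.Ioo (0 : ℝ) 1 →
      ∀ (d : ℕ) (Ω : Type) [Fintype Ω] [DecidableEq Ω] [Nonempty Ω],
        Fintype.card Ω = d →
        ∀ m : ℕ, ∃ κhat : (Fin m → Ω) → ℝ,
          (∀ x, κhat x ∈ Set.Ioo (0 : ℝ) 1) ∧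
          ∀ (M : Matrix Ω Ω ℝ) (μ π : Ω → ℝ),
            IsStochastic M → IsErgodic M → IsDist μ → IsDist π →
            Matrix.vecMul π M = π →
            (m : ℝ) ≥ c * (c' * Real.log ((d : ℝ) / (δ * ε * piMinOf π * (1 - genCC M))) *
                Real.log (Real.log ((d : ℝ) / (δ * ε * piMinOf π * (1 - genCC M))))) * (d : ℝ) /
                (piMinOf π * (1 - genCC M) ^ 2 * ε ^ 2) →
            1 - δ ≤ prTraj μ M m {x | |(1 - κhat x) / (1 - genCC M) - 1| < ε} := by
  refine ⟨1, one_pos, 10240, by norm_num, ?_⟩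
  intro ε δ hε hδ d Ω _ _ _ hcard m
  have hε0 := hε.1
  have hε1 := hε.2
  have hδ0 := hδ.1
  have hδ1 := hδ.2
  by_cases hd1 : d = 1
  · refine ⟨fun _ => ε / 2, fun _ => ⟨by linarith, by linarith⟩, ?_⟩
    intro M μ π hM hE hμ _ _ _
    have hsing : Subsingleton Ω := Fintype.card_le_one_iff_subsingleton.1 (by omega)
    have hg : 1 - genCC M = 1 := by
      refine le_antisymm (one_sub_genCC_le_one M) ?_
      have h0 : dobrushin (M ^ 1) ≤ 0 := dobrushin_le fun i j => by
        rw [Subsingleton.elim i j]; simp [tvDist]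
      have := div_le_one_sub_genCC M one_pos
      rw [Nat.cast_one, div_one] at this
      linarith
    have huniv : {x : Fin m → Ω | |(1 - ε / 2) / (1 - genCC M) - 1| < ε} = Set.univ := by
      refine Set.eq_univ_of_forall fun x => ?_
      change |(1 - ε / 2) / (1 - genCC M) - 1| < ε
      rw [hg, div_one, abs_lt]
      constructor <;> linarith
    rw [huniv, prTraj_univ hμ hM]
    linarith
  · refine ⟨genCCEst ε, genCCEst_mem hε, ?_⟩
    intro M μ π hM hE hμ hπ hs hm
    have hg := one_sub_genCC_pos hM hE
    have hg1 := one_sub_genCC_le_one M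
    have hp := piMinOf_pos hE hπ hs
    have hdp := card_mul_piMinOf_le hπ
    have hd2 : (2 : ℝ) ≤ d := by
      have : 0 < d := hcard ▸ Fintype.card_pos
      exact_mod_cast (show 2 ≤ d by omega)
    rw [hcard] at hdp
    set p := piMinOf π
    set g := 1 - genCC M
    set R := (d : ℝ) / (δ * ε * p * g) with hRdef
    have hp1 : p ≤ 1 := by nlinarith
    have hden : 0 < δ * ε * p * g := by positivity
    have hR : 4 ≤ R := by
      rw [hRdef, le_div_iff₀ hden]
      have h1 : δ * ε ≤ 1 := mul_le_one₀ hδ1.le hε0.le hε1.le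
      have h2 : δ * ε * g ≤ 1 := mul_le_one₀ h1 hg.le hg1
      have h3 : δ * ε * p * g ≤ p := by
        calc δ * ε * p * g = p * (δ * ε * g) := by ring
          _ ≤ p := mul_le_of_le_one_right hp.le h2
      nlinarith
    have hRδ : (d : ℝ) ≤ R * δ * g := by
      have e : R * δ * g = d / (ε * p) := by rw [hRdef]; field_simp
      rw [e]
      exact le_div_self (by linarith) (by positivity) (mul_le_one₀ hε1.le hp.le hp1)
    have hlog : 1.38 ≤ Real.log R := by
      have h4 : Real.log 4 = 2 * Real.log 2 := by
        rw [show (4 : ℝ) = 2 ^ 2 by norm_num, Real.log_pow]; norm_num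
      have := Real.log_le_log (by norm_num) hR
      linarith [Real.log_two_gt_d9]
    have hloglog : 1 / 4 ≤ Real.log (Real.log R) := by
      have h1 := Real.one_sub_inv_le_log_of_pos (show (0 : ℝ) < 1.38 by norm_num)
      have h2 := Real.log_le_log (by norm_num) hlog
      norm_num at h1 h2 ⊢
      linarith
    refine prTraj_genCCEst_ge hε hδ hM hE hμ hπ hs hR (by rw [hcard]; exact hRδ) ?_
    rw [ge_iff_le, div_le_iff₀ (by positivity)] at hm
    rw [hcard]
    have h1 : 0 ≤ d * Real.log R := by positivity
    have h2 := mul_le_mul_of_nonneg_left hloglog h1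
    change _ ≤ (m : ℝ) * p * g ^ 2 * ε ^ 2
    linarith
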